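/- Assume the Lr (a,τ) interval exchange transformation T is irreducible, satisfies the Keane Condition, and τ is fully split. Then no pair of distinct points of X is doubly asymptotic for the shift S. -/

import Mathlib

open Set

noncomputable section

/-- `bpt a k = a_1 + ⋯ + a_k` (0-indexed: the sum of the first `k` entries of `a`);
these are the division points `b_k` of the interval exchange. -/
def bpt {n : ℕ} (a : Fin n → ℝ) (k : ℕ) : ℝ :=
  ∑ j ∈ Finset.univ.filter (fun j : Fin n => (j : ℕ) < k), a j

/-- The left-closed right-open interval `J_i = [b_{i-1}, b_i)` (0-indexed). -/
def Jint {n : ℕ} (a : Fin n → ℝ) (i : Fin n) : Set ℝ :=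
  Set.Ico (bpt a (i : ℕ)) (bpt a ((i : ℕ) + 1))

/-- The left-open right-closed interval `J̃_i = (b_{i-1}, b_i]` (0-indexed). -/
def Jtil {n : ℕ} (a : Fin n → ℝ) (i : Fin n) : Set ℝ :=
  Set.Ioc (bpt a (i : ℕ)) (bpt a ((i : ℕ) + 1))

/-- The permuted probability vector `a^τ`, with `a^τ_{τ(i)} = a_i`. -/
def aperm {n : ℕ} (a : Fin n → ℝ) (τ : Equiv.Perm (Fin n)) : Fin n → ℝ :=
  fun j => a (τ.symm j)

/-- The set `D = {b_1, …, b_{n-1}}` of interior division points. -/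
def Dset {n : ℕ} (a : Fin n → ℝ) : Set ℝ :=
  {x | ∃ k : ℕ, 0 < k ∧ k < n ∧ x = bpt a k}

/-- `a` is a positive probability vector. -/
def IsProbVec {n : ℕ} (a : Fin n → ℝ) : Prop :=
  (∀ i, 0 < a i) ∧ ∑ i, a i = 1

/-- `T` is the Lr `(a,τ)` interval exchange transformation: on each
`J_i = [b_{i-1}, b_i)` it is the translation `x ↦ x - b_{i-1} + b^τ_{τ(i)-1}`. -/
def IsLrIET {n : ℕ} (a : Fin n → ℝ) (τ : Equiv.Perm (Fin n)) (T : ℝ → ℝ) : Prop :=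
  ∀ i : Fin n, ∀ x ∈ Jint a i, T x = x - bpt a (i : ℕ) + bpt (aperm a τ) ((τ i : ℕ))

/-- `Tt` is the dual lR `(a,τ)` interval exchange transformation: on each
`J̃_i = (b_{i-1}, b_i]` it is the translation `x ↦ x - b_{i-1} + b^τ_{τ(i)-1}`. -/
def IslRIET {n : ℕ} (a : Fin n → ℝ) (τ : Equiv.Perm (Fin n)) (Tt : ℝ → ℝ) : Prop :=
  ∀ i : Fin n, ∀ x ∈ Jtil a i, Tt x = x - bpt a (i : ℕ) + bpt (aperm a τ) ((τ i : ℕ))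

/-- The Keane Condition: `D ∩ T^k(D) = ∅` for every positive integer `k`. -/
def KeaneCond {n : ℕ} (a : Fin n → ℝ) (T : ℝ → ℝ) : Prop :=
  ∀ k : ℕ, 0 < k → Dset a ∩ (T^[k] '' Dset a) = ∅

/-- `τ` is irreducible: `τ({1,…,j}) ≠ {1,…,j}` for `j = 1, …, n-1` (0-indexed:
no proper initial segment is invariant). -/
def IrreduciblePerm {n : ℕ} (τ : Equiv.Perm (Fin n)) : Prop :=
  ∀ j : ℕ, 0 < j → j < n →
    (fun i => τ i) '' {i : Fin n | (i : ℕ) < j} ≠ {i : Fin n | (i : ℕ) < j}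

/-- `P` is the family of ℤ-iterates of `T` on `[0,1)`: `P 0 = id`,
`P (k+1) = T ∘ P k`, and each `P k` maps `[0,1)` into itself. -/
def IsZIterLr (T : ℝ → ℝ) (P : ℤ → ℝ → ℝ) : Prop :=
  (∀ x ∈ Set.Ico (0 : ℝ) 1, P 0 x = x) ∧
  ∀ k : ℤ, ∀ x ∈ Set.Ico (0 : ℝ) 1, P k x ∈ Set.Ico (0 : ℝ) 1 ∧ P (k + 1) x = T (P k x)

/-- `Pt` is the family of ℤ-iterates of `Tt` on `(0,1]`. -/
def IsZIterlR (Tt : ℝ → ℝ) (Pt : ℤ → ℝ → ℝ) : Prop :=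
  (∀ x ∈ Set.Ioc (0 : ℝ) 1, Pt 0 x = x) ∧
  ∀ k : ℤ, ∀ x ∈ Set.Ioc (0 : ℝ) 1, Pt k x ∈ Set.Ioc (0 : ℝ) 1 ∧ Pt (k + 1) x = Tt (Pt k x)

/-- `I` is the itinerary map of `T` (with ℤ-iterates `P`):
`𝓘(x)_k = i ↔ T^k x ∈ J_i` for `x ∈ [0,1)`. -/
def IsItin {n : ℕ} (a : Fin n → ℝ) (P : ℤ → ℝ → ℝ) (I : ℝ → ℤ → Fin n) : Prop :=
  ∀ x ∈ Set.Ico (0 : ℝ) 1, ∀ k : ℤ, ∀ i : Fin n, (I x k = i ↔ P k x ∈ Jint a i)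

/-- `It` is the itinerary map of `Tt` (with ℤ-iterates `Pt`):
`𝓘̃(x)_k = i ↔ T̃^k x ∈ J̃_i` for `x ∈ (0,1]`. -/
def IsItinDual {n : ℕ} (a : Fin n → ℝ) (Pt : ℤ → ℝ → ℝ) (It : ℝ → ℤ → Fin n) : Prop :=
  ∀ x ∈ Set.Ioc (0 : ℝ) 1, ∀ k : ℤ, ∀ i : Fin n, (It x k = i ↔ Pt k x ∈ Jtil a i)

/-- `D_∞ = {0,1} ∪ ⋃_{k ∈ ℤ} T^k(D)`. -/
def Dinf {n : ℕ} (a : Fin n → ℝ) (P : ℤ → ℝ → ℝ) : Set ℝ :=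
  {0, 1} ∪ ⋃ k : ℤ, P k '' Dset a

/-- The set `R = [0,1] ∖ D_∞` of regular points. -/
def Rset {n : ℕ} (a : Fin n → ℝ) (P : ℤ → ℝ → ℝ) : Set ℝ :=
  Set.Icc 0 1 \ Dinf a P

/-- The shift `S` on `Ω = {1,…,n}^ℤ`: `S(α)_i = α_{i+1}`. -/
def shiftS {n : ℕ} (α : ℤ → Fin n) : ℤ → Fin n := fun i => α (i + 1)

/-- The `k`-th power of the shift: `(S^k α)_i = α_{i+k}`. -/
def shiftZ {n : ℕ} (k : ℤ) (α : ℤ → Fin n) : ℤ → Fin n := fun i => α (i + k)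

/-- `α, β` are positively asymptotic: `α_i = β_i` for all `i ≥ N`, some `N`. -/
def PosAsymp {n : ℕ} (α β : ℤ → Fin n) : Prop :=
  ∃ N : ℕ, ∀ i : ℤ, (N : ℤ) ≤ i → α i = β i

/-- `α, β` are negatively asymptotic: `α_i = β_i` for all `i ≤ -N`, some `N`. -/
def NegAsymp {n : ℕ} (α β : ℤ → Fin n) : Prop :=
  ∃ N : ℕ, ∀ i : ℤ, i ≤ -(N : ℤ) → α i = β i

/-- `τ` is split: `τ(j+1) ≠ τ(j) + 1` for `j = 1, …, n-1`. -/
def SplitPerm {n : ℕ} (τ : Equiv.Perm (Fin n)) : Prop :=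
  ∀ i j : Fin n, (j : ℕ) = (i : ℕ) + 1 → (τ j : ℕ) ≠ (τ i : ℕ) + 1

/-- `τ` is fully split: split, and moreover `τ(1) ≠ τ(n) + 1` and
`τ⁻¹(1) ≠ τ⁻¹(n) + 1`. -/
def FullySplitPerm {n : ℕ} (τ : Equiv.Perm (Fin n)) : Prop :=
  SplitPerm τ ∧ ∀ i j : Fin n, (i : ℕ) = 0 → (j : ℕ) = n - 1 →
    (τ i : ℕ) ≠ (τ j : ℕ) + 1 ∧ (τ.symm i : ℕ) ≠ (τ.symm j : ℕ) + 1

section DivisionPoints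

variable {n : ℕ} {a : Fin n → ℝ}

lemma bpt_zero (a : Fin n → ℝ) : bpt a 0 = 0 := by simp [bpt]

lemma bpt_succ (a : Fin n → ℝ) (i : Fin n) :
    bpt a ((i : ℕ) + 1) = bpt a (i : ℕ) + a i := by
  have h : Finset.univ.filter (fun j : Fin n => (j : ℕ) < (i : ℕ) + 1)
      = insert i (Finset.univ.filter (fun j : Fin n => (j : ℕ) < (i : ℕ))) := by
    ext j
    simp only [Finset.mem_filter, Finset.mem_univ, true_and, Finset.mem_insert, Fin.ext_iff]
    omega
  rw [bpt, h, Finset.sum_insert (by simp), bpt, add_comm]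

lemma bpt_top (ha : IsProbVec a) : bpt a n = 1 := by
  rw [← ha.2, bpt]
  congr 1
  ext j
  simp

lemma bpt_mono (ha : IsProbVec a) : Monotone (bpt a) := fun k m hkm =>
  Finset.sum_le_sum_of_subset_of_nonneg
    (fun j hj => by
      simp only [Finset.mem_filter, Finset.mem_univ, true_and] at hj ⊢
      omega)
    (fun j _ _ => (ha.1 j).le)

lemma bpt_lt_succ (ha : IsProbVec a) (i : Fin n) : bpt a (i : ℕ) < bpt a ((i : ℕ) + 1) := by
  rw [bpt_succ]
  linarith [ha.1 i]

lemma bpt_strictMono (ha : IsProbVec a) {k m : ℕ} (hkm : k < m) (hm : m ≤ n) :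
    bpt a k < bpt a m :=
  (bpt_lt_succ ha ⟨k, by omega⟩).trans_le (bpt_mono ha hkm)

lemma le_of_bpt_lt (ha : IsProbVec a) {k m : ℕ} (h : bpt a k < bpt a (m + 1)) : k ≤ m := by
  by_contra hc
  exact absurd (bpt_mono ha (show m + 1 ≤ k by omega)) (not_le.2 h)

lemma bpt_mem_Icc (ha : IsProbVec a) {k : ℕ} (hk : k ≤ n) : bpt a k ∈ Icc (0 : ℝ) 1 :=
  ⟨bpt_zero a ▸ bpt_mono ha (Nat.zero_le k), bpt_top ha ▸ bpt_mono ha hk⟩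

lemma isProbVec_aperm (ha : IsProbVec a) (τ : Equiv.Perm (Fin n)) : IsProbVec (aperm a τ) :=
  ⟨fun i => ha.1 _, by rw [← ha.2]; exact Equiv.sum_comp τ.symm a⟩

lemma Jint_unique (ha : IsProbVec a) {x : ℝ} {i j : Fin n} (hi : x ∈ Jint a i)
    (hj : x ∈ Jint a j) : i = j :=
  Fin.ext (le_antisymm (le_of_bpt_lt ha (hi.1.trans_lt hj.2))
    (le_of_bpt_lt ha (hj.1.trans_lt hi.2)))

lemma Jtil_unique (ha : IsProbVec a) {x : ℝ} {i j : Fin n} (hi : x ∈ Jtil a i)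
    (hj : x ∈ Jtil a j) : i = j :=
  Fin.ext (le_antisymm (le_of_bpt_lt ha (hi.1.trans_le hj.2))
    (le_of_bpt_lt ha (hj.1.trans_le hi.2)))

/-- A point of the open interval with index `i` lies in no other closed interval. -/
lemma index_eq_of_mem_Ioo (ha : IsProbVec a) {x : ℝ} {i j : Fin n}
    (hi : x ∈ Ioo (bpt a (i : ℕ)) (bpt a ((i : ℕ) + 1)))
    (hj : x ∈ Icc (bpt a (j : ℕ)) (bpt a ((j : ℕ) + 1))) : i = j :=
  Fin.ext (le_antisymm (le_of_bpt_lt ha (hi.1.trans_le hj.2))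
    (le_of_bpt_lt ha (hj.1.trans_lt hi.2)))

lemma Jint_subset (ha : IsProbVec a) {x : ℝ} {i : Fin n} (hx : x ∈ Jint a i) :
    x ∈ Ico (0 : ℝ) 1 :=
  ⟨(bpt_mem_Icc ha i.2.le).1.trans hx.1, hx.2.trans_le (bpt_mem_Icc ha i.2).2⟩

lemma exists_mem_Jint (ha : IsProbVec a) {x : ℝ} (hx : x ∈ Ico (0 : ℝ) 1) :
    ∃ i, x ∈ Jint a i := by
  classical
  have hex : ∃ k, x < bpt a k := ⟨n, by rw [bpt_top ha]; exact hx.2⟩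
  have hlt := Nat.find_spec hex
  have hmin : ∀ m < Nat.find hex, ¬ x < bpt a m := fun m => Nat.find_min hex
  have hle : Nat.find hex ≤ n := Nat.find_min' hex (by rw [bpt_top ha]; exact hx.2)
  rcases hk : Nat.find hex with _ | m
  · rw [hk, bpt_zero] at hlt
    exact absurd hx.1 (not_le.2 hlt)
  · rw [hk] at hlt hmin hle
    exact ⟨⟨m, hle⟩, not_lt.1 (hmin m (Nat.lt_succ_self m)), hlt⟩

/-- A point of `J_i` is an interior point unless it belongs to `D ∪ {0}`. -/
lemma mem_Ioo_of_mem_Jint {x : ℝ} {i : Fin n} (hx : x ∈ Jint a i) (h0 : x ≠ 0)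
    (hD : x ∉ Dset a) : x ∈ Ioo (bpt a (i : ℕ)) (bpt a ((i : ℕ) + 1)) := by
  refine ⟨lt_of_le_of_ne hx.1 fun h => ?_, hx.2⟩
  rcases Nat.eq_zero_or_pos (i : ℕ) with hi | hi
  · exact h0 (by rw [← h, hi, bpt_zero])
  · exact hD ⟨i, hi, i.2, h.symm⟩

/-- A point of `J̃_i` is an interior point unless it belongs to `D ∪ {1}`. -/
lemma mem_Ioo_of_mem_Jtil (ha : IsProbVec a) {x : ℝ} {i : Fin n} (hx : x ∈ Jtil a i)
    (h1 : x ≠ 1) (hD : x ∉ Dset a) : x ∈ Ioo (bpt a (i : ℕ)) (bpt a ((i : ℕ) + 1)) := by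
  refine ⟨hx.1, lt_of_le_of_ne hx.2 fun h => ?_⟩
  rcases Nat.lt_or_ge ((i : ℕ) + 1) n with hi | hi
  · exact hD ⟨i + 1, by omega, hi, h⟩
  · exact h1 (by rw [h, show (i : ℕ) + 1 = n by omega, bpt_top ha])

end DivisionPoints

section Translation

variable {n : ℕ} {a : Fin n → ℝ} {τ : Equiv.Perm (Fin n)} {T : ℝ → ℝ}

/-- The amount by which the interval exchange translates the `i`-th interval. -/
def translen (a : Fin n → ℝ) (τ : Equiv.Perm (Fin n)) (i : Fin n) : ℝ :=
  bpt (aperm a τ) (τ i : ℕ) - bpt a (i : ℕ)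

lemma bpt_add_translen (a : Fin n → ℝ) (τ : Equiv.Perm (Fin n)) (i : Fin n) :
    bpt a (i : ℕ) + translen a τ i = bpt (aperm a τ) (τ i : ℕ) := by
  simp [translen]

lemma bpt_succ_add_translen (a : Fin n → ℝ) (τ : Equiv.Perm (Fin n)) (i : Fin n) :
    bpt a ((i : ℕ) + 1) + translen a τ i = bpt (aperm a τ) ((τ i : ℕ) + 1) := by
  rw [bpt_succ, bpt_succ, translen, aperm, Equiv.symm_apply_apply]
  ring

lemma IsLrIET.apply_eq (hT : IsLrIET a τ T) {i : Fin n} {x : ℝ} (hx : x ∈ Jint a i) :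
    T x = x + translen a τ i := by
  rw [hT i x hx, translen]
  ring

lemma add_translen_mem_Jint {i : Fin n} {x : ℝ} (hx : x ∈ Jint a i) :
    x + translen a τ i ∈ Jint (aperm a τ) (τ i) := by
  have h1 := bpt_add_translen a τ i
  have h2 := bpt_succ_add_translen a τ i
  exact ⟨by linarith [hx.1], by linarith [hx.2]⟩

lemma IsLrIET.apply_bpt (ha : IsProbVec a) (hT : IsLrIET a τ T) (i : Fin n) :
    T (bpt a (i : ℕ)) = bpt (aperm a τ) (τ i : ℕ) := by
  rw [hT.apply_eq (i := i) ⟨le_rfl, bpt_lt_succ ha i⟩, bpt_add_translen]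

lemma IsLrIET.mapsTo (ha : IsProbVec a) (hT : IsLrIET a τ T) :
    MapsTo T (Ico 0 1) (Ico 0 1) := by
  intro x hx
  obtain ⟨i, hi⟩ := exists_mem_Jint ha hx
  rw [hT.apply_eq hi]
  exact Jint_subset (isProbVec_aperm ha τ) (add_translen_mem_Jint hi)

lemma IsLrIET.injOn (ha : IsProbVec a) (hT : IsLrIET a τ T) : InjOn T (Ico 0 1) := by
  intro x hx y hy hxy
  obtain ⟨i, hi⟩ := exists_mem_Jint ha hx
  obtain ⟨j, hj⟩ := exists_mem_Jint ha hy
  rw [hT.apply_eq hi, hT.apply_eq hj] at hxy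
  have hij : i = j := τ.injective <| Jint_unique (isProbVec_aperm ha τ)
    (add_translen_mem_Jint hi) (hxy ▸ add_translen_mem_Jint hj)
  subst hij
  linarith

/-- For an irreducible interval exchange the preimage of `0` is a division point. -/
lemma IsLrIET.mem_Dset_of_apply_eq_zero (hn : 2 ≤ n) (ha : IsProbVec a) (hT : IsLrIET a τ T)
    (hirr : IrreduciblePerm τ) {x : ℝ} (hx : x ∈ Ico (0 : ℝ) 1) (h0 : T x = 0) :
    x ∈ Dset a := by
  obtain ⟨i, hi⟩ := exists_mem_Jint ha hx
  have hTx := hT.apply_eq hi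
  have hsum := bpt_add_translen a τ i
  have ha' := isProbVec_aperm ha τ
  have hnn := (bpt_mem_Icc ha' (τ i).2.le).1
  have hxi : x = bpt a (i : ℕ) := le_antisymm (by linarith) hi.1
  have hτi : (τ i : ℕ) = 0 := by
    by_contra hne
    have := bpt_strictMono ha' (Nat.pos_of_ne_zero hne) (τ i).2.le
    rw [bpt_zero] at this
    linarith
  refine ⟨i, Nat.pos_of_ne_zero fun hi0 => ?_, i.2, hxi⟩
  refine hirr 1 one_pos (by omega) ?_
  have hii : τ i = i := Fin.ext (by omega)
  have hset : {j : Fin n | (j : ℕ) < 1} = {i} := by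
    ext j
    simp only [mem_ofPred_eq, mem_singleton_iff, Fin.ext_iff]
    omega
  rw [hset, image_singleton, hii]

end Translation

section PiecewiseTranslation

variable {κ : Type*} {G : ℝ → ℝ} {L : ℝ → κ} {s : κ → ℝ}

lemma iterate_eq_add_sum (hG : MapsTo G (Ico 0 1) (Ico 0 1))
    (hs : ∀ z ∈ Ico (0 : ℝ) 1, G z = z + s (L z)) {z : ℝ} (hz : z ∈ Ico (0 : ℝ) 1) (k : ℕ) :
    G^[k] z = z + ∑ i ∈ Finset.range k, s (L (G^[i] z)) := by
  induction k with
  | zero => simp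
  | succ k ih =>
    rw [Function.iterate_succ_apply', hs _ (hG.iterate k hz), Finset.sum_range_succ]
    linarith

lemma exists_dist_lt_of_mem_Icc {u : ℕ → ℝ} (hu : ∀ k, u k ∈ Icc (0 : ℝ) 1) {δ : ℝ}
    (hδ : 0 < δ) : ∃ k m, k < m ∧ |u m - u k| < δ := by
  obtain ⟨x, -, φ, hφ, hlim⟩ := isCompact_Icc.tendsto_subseq hu
  obtain ⟨N, hN⟩ := Metric.cauchySeq_iff'.1 hlim.cauchySeq δ hδ
  exact ⟨φ N, φ (N + 1), hφ (Nat.lt_succ_self N), hN (N + 1) (Nat.le_succ N)⟩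

/-- For an injective piecewise translation of `[0,1)` with interval pieces, if two distinct points
have the same coding then all the points with that coding are periodic with a common period. -/
lemma exists_period_of_coding_eq (hG : MapsTo G (Ico 0 1) (Ico 0 1)) (hinj : InjOn G (Ico 0 1))
    (hs : ∀ z ∈ Ico (0 : ℝ) 1, G z = z + s (L z))
    (hL : ∀ z₁ ∈ Ico (0 : ℝ) 1, ∀ z₂ ∈ Ico (0 : ℝ) 1, L z₁ = L z₂ → ∀ z ∈ Icc z₁ z₂, L z = L z₁)
    {x y : ℝ} (hx : x ∈ Ico (0 : ℝ) 1) (hy : y ∈ Ico (0 : ℝ) 1) (hxy : x < y)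
    (hcode : ∀ k, L (G^[k] y) = L (G^[k] x)) :
    ∃ p, 0 < p ∧ ∀ z ∈ Ico (0 : ℝ) 1, (∀ k, L (G^[k] z) = L (G^[k] x)) → G^[p] z = z := by
  set w : ℕ → κ := fun k => L (G^[k] x) with hw
  set c : ℕ → ℝ := fun k => ∑ i ∈ Finset.range k, s (w i) with hc
  have htrans : ∀ z ∈ Ico (0 : ℝ) 1, (∀ k, L (G^[k] z) = w k) → ∀ k, G^[k] z = z + c k := by
    intro z hz hzw k
    rw [iterate_eq_add_sum hG hs hz k]
    simp only [hzw, hc]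
  have hmid : ∀ z ∈ Icc x y, ∀ k, L (G^[k] z) = w k := by
    intro z hz k
    have hzS : z ∈ Ico (0 : ℝ) 1 := ⟨hx.1.trans hz.1, hz.2.trans_lt hy.2⟩
    induction k using Nat.strong_induction_on with
    | _ k ih =>
      have hzk : G^[k] z = z + c k := by
        rw [iterate_eq_add_sum hG hs hzS k]
        congr 1
        exact Finset.sum_congr rfl fun i hi => by rw [ih i (Finset.mem_range.1 hi)]
      refine hL _ (hG.iterate k hx) _ (hG.iterate k hy) (hcode k).symm _ ?_
      rw [hzk, htrans x hx (fun _ => rfl) k, htrans y hy hcode k]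
      exact ⟨by linarith [hz.1], by linarith [hz.2]⟩
  have hret : ∃ p, 0 < p ∧ ∃ z ∈ Icc x y, G^[p] z ∈ Icc x y := by
    obtain ⟨k, m, hkm, hd⟩ := exists_dist_lt_of_mem_Icc
      (fun k => Ico_subset_Icc_self (hG.iterate k hx)) (sub_pos.2 hxy)
    rw [htrans x hx (fun _ => rfl), htrans x hx (fun _ => rfl), abs_lt] at hd
    have key : ∀ z ∈ Icc x y, z + (c m - c k) ∈ Icc x y → G^[m - k] z = z + (c m - c k) := by
      intro z hz hz'
      have hzS : z ∈ Ico (0 : ℝ) 1 := ⟨hx.1.trans hz.1, hz.2.trans_lt hy.2⟩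
      have hzS' : z + (c m - c k) ∈ Ico (0 : ℝ) 1 := ⟨hx.1.trans hz'.1, hz'.2.trans_lt hy.2⟩
      refine (hinj.iterate hG k) (hG.iterate _ hzS) hzS' ?_
      rw [← Function.iterate_add_apply, Nat.add_sub_cancel' hkm.le,
        htrans z hzS (hmid z hz), htrans _ hzS' (hmid _ hz')]
      ring
    refine ⟨m - k, by omega, ?_⟩
    rcases le_or_gt 0 (c m - c k) with h | h
    · have hz' : x + (c m - c k) ∈ Icc x y := ⟨by linarith, by linarith⟩
      exact ⟨x, ⟨le_rfl, hxy.le⟩, (key x ⟨le_rfl, hxy.le⟩ hz').symm ▸ hz'⟩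
    · have hz' : y + (c m - c k) ∈ Icc x y := ⟨by linarith, by linarith⟩
      exact ⟨y, ⟨hxy.le, le_rfl⟩, (key y ⟨hxy.le, le_rfl⟩ hz').symm ▸ hz'⟩
  obtain ⟨p, hp, z, hz, hz'⟩ := hret
  have hper : ∀ k, w (k + p) = w k := fun k => by
    rw [← hmid z hz, Function.iterate_add_apply, hmid _ hz']
  have hjump : ∀ j : ℕ, (G^[p])^[j] x = x + j * c p ∧ ∀ k, L (G^[k] ((G^[p])^[j] x)) = w k := by
    intro j
    induction j with
    | zero => simp [hw]
    | succ j ih =>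
      have hS : (G^[p])^[j] x ∈ Ico (0 : ℝ) 1 := (hG.iterate p).iterate j hx
      rw [Function.iterate_succ_apply']
      refine ⟨?_, fun k => ?_⟩
      · rw [htrans _ hS ih.2, ih.1]
        push_cast
        ring
      · rw [← Function.iterate_add_apply, ih.2, hper]
  have hcp : c p = 0 := by
    by_contra hne
    obtain ⟨j, hj⟩ := exists_nat_gt (1 / |c p|)
    rw [div_lt_iff₀ (abs_pos.2 hne)] at hj
    have hS : (G^[p])^[j] x ∈ Ico (0 : ℝ) 1 := (hG.iterate p).iterate j hx
    rw [(hjump j).1] at hS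
    have : |(j : ℝ) * c p| ≤ 1 :=
      abs_le.2 ⟨by linarith [hS.1, hx.2], by linarith [hS.2, hx.1]⟩
    rw [abs_mul, Nat.abs_cast] at this
    linarith
  exact ⟨p, hp, fun z hz hzw => by rw [htrans z hz hzw, hcp, add_zero]⟩

end PiecewiseTranslation

section Separation

variable {n : ℕ} {a : Fin n → ℝ} {τ : Equiv.Perm (Fin n)} {T : ℝ → ℝ}

lemma KeaneCond.not_mem (hK : KeaneCond a T) {k : ℕ} (hk : 0 < k) {d : ℝ} (hd : d ∈ Dset a) :
    T^[k] d ∉ Dset a := fun h => by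
  have := hK k hk
  exact (this ▸ (⟨h, d, hd, rfl⟩ : T^[k] d ∈ Dset a ∩ T^[k] '' Dset a) : T^[k] d ∈ (∅ : Set ℝ))

/-- Under the Keane condition distinct points have distinct forward codings. -/
lemma forward_coding_ne (hn : 2 ≤ n) (ha : IsProbVec a) (hT : IsLrIET a τ T)
    (hirr : IrreduciblePerm τ) (hK : KeaneCond a T) {L : ℝ → Fin n}
    (hL : ∀ z ∈ Ico (0 : ℝ) 1, z ∈ Jint a (L z)) {x y : ℝ} (hx : x ∈ Ico (0 : ℝ) 1)
    (hy : y ∈ Ico (0 : ℝ) 1) (hxy : x < y) : ¬ ∀ k, L (T^[k] y) = L (T^[k] x) := by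
  intro hcode
  have hmaps := hT.mapsTo ha
  have hs : ∀ z ∈ Ico (0 : ℝ) 1, T z = z + translen a τ (L z) := fun z hz => hT.apply_eq (hL z hz)
  have hLeq : ∀ {z : ℝ} {i : Fin n}, z ∈ Jint a i → L z = i := fun {z i} hz =>
    Jint_unique ha (hL z (Jint_subset ha hz)) hz
  obtain ⟨p, hp, hper⟩ := exists_period_of_coding_eq hmaps (hT.injOn ha) hs
    (fun z₁ h₁ z₂ h₂ h z hz => hLeq
      ⟨(hL z₁ h₁).1.trans hz.1, hz.2.trans_lt (h ▸ (hL z₂ h₂).2)⟩) hx hy hxy hcode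
  set w : ℕ → Fin n := fun k => L (T^[k] x) with hw
  set c : ℕ → ℝ := fun k => ∑ i ∈ Finset.range k, translen a τ (w i) with hc
  set C : Set ℝ := {z | z ∈ Ico (0 : ℝ) 1 ∧ ∀ k, L (T^[k] z) = w k} with hC
  have htrans : ∀ z ∈ C, ∀ k, T^[k] z = z + c k := by
    rintro z ⟨hz, hzw⟩ k
    rw [iterate_eq_add_sum hmaps hs hz k]
    simp only [hzw, hc]
  have hbox : ∀ z ∈ C, ∀ k, z + c k ∈ Jint a (w k) := fun z hz k => by
    rw [← htrans z hz k, ← hz.2 k]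
    exact hL _ (hmaps.iterate k hz.1)
  have hofbox : ∀ z, (∀ k, z + c k ∈ Jint a (w k)) → z ∈ C := by
    intro z hz
    have hit : ∀ k, T^[k] z = z + c k := by
      intro k
      induction k with
      | zero => simp [hc]
      | succ k ih =>
        rw [Function.iterate_succ_apply', ih, hT.apply_eq (hz k)]
        simp only [hc, Finset.sum_range_succ]
        ring
    refine ⟨by simpa [hc] using Jint_subset ha (hz 0), fun k => ?_⟩
    rw [hit]
    exact hLeq (hz k)
  have hxC : x ∈ C := ⟨hx, fun _ => rfl⟩
  have hbdd : BddBelow C := ⟨0, fun z hz => hz.1.1⟩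
  set l := sInf C with hl
  have hlC : l ∈ C := by
    refine hofbox l fun k => ⟨?_, ?_⟩
    · have : bpt a (w k : ℕ) - c k ≤ l :=
        le_csInf ⟨x, hxC⟩ fun z hz => by linarith [(hbox z hz k).1]
      linarith
    · linarith [csInf_le hbdd hxC, (hbox x hxC k).2]
  have hlp : T^[p] l = l := hper l hlC.1 hlC.2
  have hwper : ∀ k, w k = w (k % p) := fun k => by
    simp only [hw, Function.IsPeriodicPt.iterate_mod_apply (hper x hx fun _ => rfl) k]
  have hcper : ∀ k, c k = c (k % p) := fun k => by
    have h1 := htrans x hxC k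
    have h2 := htrans x hxC (k % p)
    rw [Function.IsPeriodicPt.iterate_mod_apply (hper x hx fun _ => rfl) k] at h2
    linarith
  have hDl : ∀ j, T^[j] l ∉ Dset a := fun j hj => by
    refine hK.not_mem hp hj ?_
    rwa [← Function.iterate_add_apply, add_comm, Function.iterate_add_apply, hlp]
  have h0l : ∀ j, T^[j] l ≠ 0 := fun j hj => by
    refine hDl (j + (p - 1)) (hT.mem_Dset_of_apply_eq_zero hn ha hirr
      (hmaps.iterate _ hlC.1) ?_)
    rw [← Function.iterate_succ_apply' T, show (j + (p - 1)).succ = j + p by omega,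
      Function.iterate_add_apply, hlp, hj]
  have hint : ∀ k, bpt a (w k : ℕ) - c k < l := fun k => by
    have h := (mem_Ioo_of_mem_Jint (hbox l hlC k) (htrans l hlC k ▸ h0l k)
      (htrans l hlC k ▸ hDl k)).1
    linarith
  obtain ⟨z, hz, hzl⟩ : ∃ z, (∀ k ∈ Finset.range p, bpt a (w k : ℕ) - c k < z) ∧ z < l := by
    have h1 : ∀ᶠ z in nhdsWithin l (Iio l), ∀ k ∈ Finset.range p, bpt a (w k : ℕ) - c k < z :=
      (Filter.eventually_all_finset _).2 fun k _ =>
        nhdsWithin_le_nhds (lt_mem_nhds (hint k))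
    exact (h1.and self_mem_nhdsWithin).exists
  have hzC : z ∈ C := by
    refine hofbox z fun k => ?_
    have h1 := hz (k % p) (Finset.mem_range.2 (Nat.mod_lt k hp))
    rw [← hwper, ← hcper] at h1
    exact ⟨by linarith, by linarith [(hbox l hlC k).2]⟩
  exact absurd (csInf_le hbdd hzC) (not_le.2 hzl)

/-- Under the Keane condition distinct points have distinct backward codings. -/
lemma backward_coding_ne (hn : 2 ≤ n) (ha : IsProbVec a) (hT : IsLrIET a τ T)
    (hirr : IrreduciblePerm τ) (hK : KeaneCond a T) {L : ℝ → Fin n}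
    (hL : ∀ z ∈ Ico (0 : ℝ) 1, z ∈ Jint a (L z)) {U : ℝ → ℝ}
    (hU : MapsTo U (Ico 0 1) (Ico 0 1)) (hTU : ∀ z ∈ Ico (0 : ℝ) 1, T (U z) = z)
    {x y : ℝ} (hx : x ∈ Ico (0 : ℝ) 1) (hy : y ∈ Ico (0 : ℝ) 1) (hxy : x < y) :
    ¬ ∀ k, L (U (U^[k] y)) = L (U (U^[k] x)) := by
  intro hcode
  have hmaps := hT.mapsTo ha
  have hLeq : ∀ {z : ℝ} {i : Fin n}, z ∈ Jint a i → L z = i := fun {z i} hz =>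
    Jint_unique ha (hL z (Jint_subset ha hz)) hz
  have hs : ∀ z ∈ Ico (0 : ℝ) 1, U z = z + (- translen a τ (L (U z))) := fun z hz => by
    have := hT.apply_eq (hL _ (hU hz))
    rw [hTU z hz] at this
    linarith
  have hUinj : InjOn U (Ico 0 1) := fun z hz z' hz' h => by
    rw [← hTU z hz, h, hTU z' hz']
  have hUT : ∀ z ∈ Ico (0 : ℝ) 1, U (T z) = z := fun z hz =>
    hT.injOn ha (hU (hmaps hz)) hz (hTU _ (hmaps hz))
  obtain ⟨p, hp, hper⟩ := exists_period_of_coding_eq (L := fun z => L (U z))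
    (s := fun i => - translen a τ i) hU hUinj hs
    (fun z₁ h₁ z₂ h₂ h z hz => by
      have e₁ := hs z₁ h₁
      have e₂ := hs z₂ h₂
      rw [← h] at e₂
      have b₁ := hL _ (hU h₁)
      have b₂ := hL _ (hU h₂)
      rw [← h] at b₂
      have hmem : z - translen a τ (L (U z₁)) ∈ Jint a (L (U z₁)) :=
        ⟨by linarith [b₁.1, hz.1], by linarith [b₂.2, hz.2]⟩
      have hTz := hT.apply_eq hmem
      rw [sub_add_cancel] at hTz
      have hUz : U z = z - translen a τ (L (U z₁)) := by
        conv_lhs => rw [← hTz]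
        exact hUT _ (Jint_subset ha hmem)
      rw [hUz]
      exact hLeq hmem) hx hy hxy hcode
  have hcancel : ∀ z ∈ Ico (0 : ℝ) 1, ∀ k, T^[k] (U^[k] z) = z := by
    intro z hz k
    induction k with
    | zero => rfl
    | succ k ih => rw [Function.iterate_succ_apply, Function.iterate_succ_apply',
        hTU _ (hU.iterate k hz), ih]
  have hfwd : ∀ z ∈ Ico (0 : ℝ) 1, U^[p] z = z → ∀ k : ℕ,
      T^[k] z = U (U^[(k + 1) * p - k - 1] z) := by
    intro z hz hzp k
    have hk : k + 1 ≤ (k + 1) * p := Nat.le_mul_of_pos_right _ hp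
    have hfix : U^[(k + 1) * p] z = z := by
      have : Function.IsPeriodicPt U p z := hzp
      exact this.const_mul (k + 1)
    conv_lhs => rw [← hfix, show (k + 1) * p = k + ((k + 1) * p - k - 1 + 1) by omega,
      Function.iterate_add_apply]
    rw [hcancel _ (hU.iterate _ hz), Function.iterate_succ_apply']
  refine forward_coding_ne hn ha hT hirr hK hL hx hy hxy fun k => ?_
  rw [hfwd x hx (hper x hx fun _ => rfl), hfwd y hy (hper y hy hcode), hcode]

end Separation

section Orbits

variable {n : ℕ} {a : Fin n → ℝ} {τ : Equiv.Perm (Fin n)} {T : ℝ → ℝ}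

/-- `x` moves by the translations prescribed by the symbols of `α`. -/
def Follows (a : Fin n → ℝ) (τ : Equiv.Perm (Fin n)) (α : ℤ → Fin n) (x : ℤ → ℝ) : Prop :=
  ∀ k, x (k + 1) = x k + translen a τ (α k)

/-- `α` is the coding of the sequence `x` by the closed intervals. -/
def ClosedCoding (a : Fin n → ℝ) (α : ℤ → Fin n) (x : ℤ → ℝ) : Prop :=
  ∀ k, x k ∈ Icc (bpt a (α k : ℕ)) (bpt a ((α k : ℕ) + 1))

lemma exists_int_antidifference (f : ℤ → ℝ) :
    ∃ c : ℤ → ℝ, c 0 = 0 ∧ ∀ k, c (k + 1) = c k + f k := by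
  refine ⟨fun k => match k with
    | Int.ofNat m => ∑ i ∈ Finset.range m, f i
    | Int.negSucc m => - ∑ i ∈ Finset.range (m + 1), f (-((i : ℤ) + 1)), by
      change ∑ i ∈ Finset.range 0, f i = 0
      simp, ?_⟩
  intro k
  match k with
  | Int.ofNat m =>
    change ∑ i ∈ Finset.range (m + 1), f i = _
    rw [Finset.sum_range_succ]
    rfl
  | Int.negSucc 0 =>
    change ∑ i ∈ Finset.range 0, f i = - ∑ i ∈ Finset.range (0 + 1), f (-((i : ℤ) + 1)) + _
    simp [Int.negSucc_eq]
  | Int.negSucc (m + 1) =>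
    change - ∑ i ∈ Finset.range (m + 1), f (-((i : ℤ) + 1))
      = - ∑ i ∈ Finset.range (m + 1 + 1), f (-((i : ℤ) + 1)) + _
    rw [Finset.sum_range_succ _ (m + 1), Int.negSucc_eq]
    push_cast
    ring

/-- Every point of the closure of a set of itineraries codes an orbit, either by the intervals
`J_i` or by the intervals `J̃_i`. -/
lemma exists_orbit_of_mem_closure {P : ℤ → ℝ → ℝ} {I : ℝ → ℤ → Fin n} (hT : IsLrIET a τ T)
    (hP : IsZIterLr T P) (hI : IsItin a P I) {Z : Set ℝ} (hZ : Z ⊆ Ico 0 1) {α : ℤ → Fin n}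
    (hα : α ∈ closure (I '' Z)) :
    ∃ x, Follows a τ α x ∧ ((∀ k, x k ∈ Jint a (α k)) ∨ ∀ k, x k ∈ Jtil a (α k)) := by
  have happrox : ∀ N : ℕ, ∃ z ∈ Ico (0 : ℝ) 1, ∀ k : ℤ, |k| ≤ N → P k z ∈ Jint a (α k) := by
    intro N
    have hopen : IsOpen (Set.pi (Icc (-(N : ℤ)) N) fun k => ({α k} : Set (Fin n))) :=
      isOpen_set_pi (finite_Icc _ _) fun k _ => isOpen_discrete _
    obtain ⟨_, hf, z, hz, rfl⟩ := mem_closure_iff.1 hα _ hopen fun k _ => rfl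
    exact ⟨z, hZ hz, fun k hk => (hI z (hZ hz) k _).1 (hf k (abs_le.1 hk))⟩
  choose z hzS hz using happrox
  obtain ⟨c, hc0, hc⟩ := exists_int_antidifference fun k => translen a τ (α k)
  have hPz : ∀ N : ℕ, ∀ k : ℤ, |k| ≤ N → P k (z N) = z N + c k := by
    intro N
    have hstep : ∀ k : ℤ, |k| ≤ N → P (k + 1) (z N) = P k (z N) + translen a τ (α k) :=
      fun k hk => by rw [(hP.2 k _ (hzS N)).2, hT.apply_eq (hz N k hk)]
    have hpos : ∀ j : ℕ, j ≤ N → P j (z N) = z N + c j := by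
      intro j
      induction j with
      | zero => intro _; simp [hP.1 _ (hzS N), hc0]
      | succ j ih =>
        intro hj
        push_cast
        rw [hstep j (by rw [Nat.abs_cast]; omega), ih (by omega), hc]
        ring
    have hneg : ∀ j : ℕ, j ≤ N → P (-j) (z N) = z N + c (-j) := by
      intro j
      induction j with
      | zero => intro _; simp [hP.1 _ (hzS N), hc0]
      | succ j ih =>
        intro hj
        have h1 := hstep (-((j + 1 : ℕ) : ℤ)) (by rw [abs_neg, Nat.abs_cast]; omega)
        have h2 := hc (-((j + 1 : ℕ) : ℤ))
        rw [show -((j + 1 : ℕ) : ℤ) + 1 = -(j : ℤ) by push_cast; ring] at h1 h2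
        linarith [ih (by omega)]
    intro k hk
    obtain ⟨j, rfl | rfl⟩ := k.eq_nat_or_neg
    · exact hpos j (by rw [Nat.abs_cast] at hk; omega)
    · exact hneg j (by rw [abs_neg, Nat.abs_cast] at hk; omega)
  obtain ⟨x, -, φ, hφ, hlim⟩ := (isCompact_Icc (a := (0 : ℝ)) (b := 1)).tendsto_subseq
    fun N => Ico_subset_Icc_self (hzS N)
  have hbox : ∀ k : ℤ, ∀ᶠ N in Filter.atTop, z (φ N) + c k ∈ Jint a (α k) := by
    intro k
    filter_upwards [Filter.eventually_ge_atTop k.natAbs] with N hN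
    have hk : |k| ≤ (φ N : ℕ) := by
      have := hφ.id_le N
      rw [Int.abs_eq_natAbs]
      simp only [id] at this
      omega
    rw [← hPz _ k hk]
    exact hz _ k hk
  have hlow : ∀ k, bpt a (α k : ℕ) ≤ x + c k := fun k =>
    ge_of_tendsto (hlim.add_const (c k)) ((hbox k).mono fun N hN => hN.1)
  have hupp : ∀ k, x + c k ≤ bpt a ((α k : ℕ) + 1) := fun k =>
    le_of_tendsto (hlim.add_const (c k)) ((hbox k).mono fun N hN => hN.2.le)
  refine ⟨fun k => x + c k, fun k => by simp only [hc]; ring, ?_⟩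
  by_cases hside : ∃ᶠ N in Filter.atTop, x ≤ z (φ N)
  · left
    intro k
    obtain ⟨N, h1, h2⟩ := (hside.and_eventually (hbox k)).exists
    exact ⟨hlow k, by linarith [h2.2]⟩
  · right
    intro k
    obtain ⟨N, h1, h2⟩ := ((Filter.not_frequently.1 hside).and (hbox k)).exists
    exact ⟨by linarith [h2.1, not_le.1 h1], hupp k⟩

/-- Orbits coded by sequences with the same future coincide. -/
lemma eq_of_forward_coding (hn : 2 ≤ n) (ha : IsProbVec a) (hT : IsLrIET a τ T)
    (hirr : IrreduciblePerm τ) (hK : KeaneCond a T) {α β : ℤ → Fin n} {x y : ℤ → ℝ}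
    (hx : Follows a τ α x) (hy : Follows a τ β y) (hαx : ClosedCoding a α x)
    (hβy : ClosedCoding a β y) {m : ℤ} (h : ∀ k, m ≤ k → α k = β k) : x m = y m := by
  by_contra hne
  wlog hlt : x m < y m generalizing α β x y
  · exact this hy hx hβy hαx (fun k hk => (h k hk).symm) (Ne.symm hne)
      (lt_of_le_of_ne (not_lt.1 hlt) (Ne.symm hne))
  have : Nonempty (Fin n) := ⟨⟨0, by omega⟩⟩
  choose! L hL using fun z (hz : z ∈ Ico (0 : ℝ) 1) => exists_mem_Jint ha hz
  have hdiff : ∀ j : ℕ, y (m + j) - x (m + j) = y m - x m := by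
    intro j
    induction j with
    | zero => simp
    | succ j ih =>
      push_cast
      rw [← add_assoc, hx, hy, h (m + j) (by omega)]
      linarith
  have hcode : ∀ z ∈ Ioo (x m) (y m), ∀ j : ℕ, z + (x (m + j) - x m) ∈ Jint a (α (m + j)) := by
    intro z hz j
    have h1 := (hαx (m + j)).1
    have h2 := (hβy (m + j)).2
    rw [← h (m + j) (by omega)] at h2
    have h3 := hdiff j
    exact ⟨by linarith [hz.1], by linarith [hz.2]⟩
  have hiter : ∀ z ∈ Ioo (x m) (y m), ∀ j : ℕ, T^[j] z = z + (x (m + j) - x m) := by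
    intro z hz j
    induction j with
    | zero => simp
    | succ j ih =>
      rw [Function.iterate_succ_apply', ih, hT.apply_eq (hcode z hz j)]
      push_cast
      rw [← add_assoc, hx]
      ring
  have hS : ∀ z ∈ Ioo (x m) (y m), z ∈ Ico (0 : ℝ) 1 := fun z hz => by
    simpa using Jint_subset ha (hcode z hz 0)
  have hLz : ∀ z ∈ Ioo (x m) (y m), ∀ j : ℕ, L (T^[j] z) = α (m + j) := fun z hz j => by
    rw [hiter z hz j]
    exact Jint_unique ha (hL _ (Jint_subset ha (hcode z hz j))) (hcode z hz j)
  obtain ⟨u, hu⟩ := exists_between hlt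
  obtain ⟨v, hv⟩ := exists_between hu.2
  have hv' : v ∈ Ioo (x m) (y m) := ⟨hu.1.trans hv.1, hv.2⟩
  exact forward_coding_ne hn ha hT hirr hK hL (hS u hu) (hS v hv') hv.1 fun k => by
    rw [hLz u hu, hLz v hv']

/-- Orbits coded by sequences with the same past coincide. -/
lemma eq_of_backward_coding (hn : 2 ≤ n) (ha : IsProbVec a) (hT : IsLrIET a τ T)
    (hirr : IrreduciblePerm τ) (hK : KeaneCond a T) {U : ℝ → ℝ}
    (hU : MapsTo U (Ico 0 1) (Ico 0 1)) (hTU : ∀ z ∈ Ico (0 : ℝ) 1, T (U z) = z)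
    {α β : ℤ → Fin n} {x y : ℤ → ℝ}
    (hx : Follows a τ α x) (hy : Follows a τ β y) (hαx : ClosedCoding a α x)
    (hβy : ClosedCoding a β y) {m : ℤ} (h : ∀ k, k < m → α k = β k) : x m = y m := by
  by_contra hne
  wlog hlt : x m < y m generalizing α β x y
  · exact this hy hx hβy hαx (fun k hk => (h k hk).symm) (Ne.symm hne)
      (lt_of_le_of_ne (not_lt.1 hlt) (Ne.symm hne))
  have : Nonempty (Fin n) := ⟨⟨0, by omega⟩⟩
  choose! L hL using fun z (hz : z ∈ Ico (0 : ℝ) 1) => exists_mem_Jint ha hz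
  have hback : ∀ j : ℕ, x (m - j) = x (m - (j + 1 : ℕ)) + translen a τ (α (m - (j + 1 : ℕ))) := by
    intro j
    rw [← hx]
    congr 1
    push_cast
    ring
  have hback' : ∀ j : ℕ, y (m - j) = y (m - (j + 1 : ℕ)) + translen a τ (β (m - (j + 1 : ℕ))) := by
    intro j
    rw [← hy]
    congr 1
    push_cast
    ring
  have hdiff : ∀ j : ℕ, y (m - j) - x (m - j) = y m - x m := by
    intro j
    induction j with
    | zero => simp
    | succ j ih =>
      have h1 := hback j
      have h2 := hback' j
      rw [← h _ (by push_cast; omega)] at h2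
      linarith
  have hcode : ∀ z ∈ Ioo (x m) (y m), ∀ j : ℕ,
      z + (x (m - (j + 1 : ℕ)) - x m) ∈ Jint a (α (m - (j + 1 : ℕ))) := by
    intro z hz j
    have h1 := (hαx (m - (j + 1 : ℕ))).1
    have h2 := (hβy (m - (j + 1 : ℕ))).2
    rw [← h _ (by push_cast; omega)] at h2
    have h3 := hdiff (j + 1)
    exact ⟨by linarith [hz.1], by linarith [hz.2]⟩
  have hUT : ∀ z ∈ Ico (0 : ℝ) 1, U (T z) = z := fun z hz =>
    hT.injOn ha (hU (hT.mapsTo ha hz)) hz (hTU _ (hT.mapsTo ha hz))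
  have hstep : ∀ z ∈ Ioo (x m) (y m), ∀ j : ℕ,
      U (z + (x (m - j) - x m)) = z + (x (m - (j + 1 : ℕ)) - x m) := by
    intro z hz j
    have h1 := hT.apply_eq (hcode z hz j)
    rw [show z + (x (m - j) - x m) = T (z + (x (m - (j + 1 : ℕ)) - x m)) by
      rw [h1, hback j]; ring]
    exact hUT _ (Jint_subset ha (hcode z hz j))
  have hiter : ∀ z ∈ Ioo (x m) (y m), ∀ j : ℕ, U^[j] z = z + (x (m - j) - x m) := by
    intro z hz j
    induction j with
    | zero => simp
    | succ j ih => rw [Function.iterate_succ_apply', ih, hstep z hz j]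
  have hS : ∀ z ∈ Ioo (x m) (y m), z ∈ Ico (0 : ℝ) 1 := fun z hz => by
    have h1 := hT.mapsTo ha (Jint_subset ha (hcode z hz 0))
    have h2 := hback 0
    rw [hT.apply_eq (hcode z hz 0)] at h1
    convert h1 using 1
    simp only [Nat.cast_zero, sub_zero] at h2
    linarith
  have hLz : ∀ z ∈ Ioo (x m) (y m), ∀ j : ℕ, L (U (U^[j] z)) = α (m - (j + 1 : ℕ)) :=
    fun z hz j => by
      rw [hiter z hz j, hstep z hz j]
      exact Jint_unique ha (hL _ (Jint_subset ha (hcode z hz j))) (hcode z hz j)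
  obtain ⟨u, hu⟩ := exists_between hlt
  obtain ⟨v, hv⟩ := exists_between hu.2
  have hv' : v ∈ Ioo (x m) (y m) := ⟨hu.1.trans hv.1, hv.2⟩
  exact backward_coding_ne hn ha hT hirr hK hL hU hTU (hS u hu) (hS v hv') hv.1 fun k => by
    rw [hLz u hu, hLz v hv']

/-- Two codings of the same kind of orbits with a common point and a common past are equal. -/
lemma coding_eq_of_common_past {J : Fin n → Set ℝ}
    (hJ : ∀ {z : ℝ} {i j : Fin n}, z ∈ J i → z ∈ J j → i = j) {α β : ℤ → Fin n} {x y : ℤ → ℝ}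
    (hx : Follows a τ α x) (hy : Follows a τ β y) (hαx : ∀ k, x k ∈ J (α k))
    (hβy : ∀ k, y k ∈ J (β k)) {m : ℤ} (hm : x m = y m) (h : ∀ k, k < m → α k = β k) :
    α = β := by
  have hxy : ∀ j : ℕ, x (m + j) = y (m + j) := by
    intro j
    induction j with
    | zero => simpa using hm
    | succ j ih =>
      push_cast
      have hβx := hβy (m + j)
      rw [← ih] at hβx
      rw [← add_assoc, hx, hy, ih, hJ (hαx (m + j)) hβx]
  funext k
  rcases lt_or_ge k m with hk | hk
  · exact h k hk
  · obtain ⟨j, rfl⟩ := Int.le.dest hk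
    have hβx := hβy (m + j)
    rw [← hxy] at hβx
    exact hJ (hαx (m + j)) hβx

/-- The one-sided orbits on the two sides of a division point never meet again. -/
lemma right_left_orbits_ne (hn : 2 ≤ n) (ha : IsProbVec a) (hT : IsLrIET a τ T)
    (hirr : IrreduciblePerm τ) (hK : KeaneCond a T) (hfs : FullySplitPerm τ)
    {α β : ℤ → Fin n} {x y : ℤ → ℝ} (hx : Follows a τ α x) (hy : Follows a τ β y)
    (hαx : ∀ k, x k ∈ Jint a (α k)) (hβy : ∀ k, y k ∈ Jtil a (β k)) {m : ℤ}
    (hm : x m = y m) (hne : α m ≠ β m) (j : ℕ) : x (m + 1 + j) ≠ y (m + 1 + j) := by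
  have ha' := isProbVec_aperm ha τ
  have hxS : ∀ k, x k ∈ Ico (0 : ℝ) 1 := fun k => Jint_subset ha (hαx k)
  have hiter : ∀ j : ℕ, x (m + j) = T^[j] (x m) := by
    intro j
    induction j with
    | zero => simp
    | succ j ih =>
      rw [Function.iterate_succ_apply', ← ih, hT.apply_eq (hαx _), ← hx]
      push_cast
      rw [add_assoc]
  have hβα : (β m : ℕ) + 1 = α m := by
    have h1 : (β m : ℕ) ≤ α m :=
      le_of_bpt_lt ha ((hβy m).1.trans (hm ▸ (hαx m).2))
    have h2 : (β m : ℕ) ≠ α m := fun h => hne (Fin.ext h.symm)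
    by_contra h3
    have h4 : bpt a ((β m : ℕ) + 1) < bpt a (α m : ℕ) :=
      bpt_strictMono ha (by omega) (α m).2.le
    linarith [(hαx m).1, (hβy m).2]
  have hxm : x m = bpt a (α m : ℕ) :=
    le_antisymm (by rw [hm, ← hβα]; exact (hβy m).2) (hαx m).1
  have hD : x m ∈ Dset a := ⟨α m, by omega, (α m).2, hxm⟩
  have hx1 : x (m + 1) = bpt (aperm a τ) (τ (α m) : ℕ) := by
    rw [hx, hxm, bpt_add_translen]
  have hy1 : y (m + 1) = bpt (aperm a τ) ((τ (β m) : ℕ) + 1) := by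
    rw [hy, ← hm, hxm, ← hβα, bpt_succ_add_translen]
  have hxD : ∀ j : ℕ, x (m + 1 + j) ∉ Dset a := fun j => by
    rw [show m + 1 + (j : ℤ) = m + (j + 1 : ℕ) by push_cast; ring, hiter]
    exact hK.not_mem (Nat.succ_pos j) hD
  have himg : ∀ k, x (k + 1) ∈ Jint (aperm a τ) (τ (α k)) := fun k =>
    hx k ▸ add_translen_mem_Jint (hαx k)
  have himg' : ∀ k, y (k + 1) ∈ Jtil (aperm a τ) (τ (β k)) := fun k => by
    have h1 := bpt_add_translen a τ (β k)
    have h2 := bpt_succ_add_translen a τ (β k)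
    have h3 := hβy k
    rw [hy k]
    exact ⟨by linarith [h3.1], by linarith [h3.2]⟩
  induction j with
  | zero =>
    simp only [Nat.cast_zero, add_zero]
    intro h
    rw [hx1, hy1] at h
    refine hfs.1 (β m) (α m) hβα.symm ?_
    rcases lt_trichotomy (τ (α m) : ℕ) ((τ (β m) : ℕ) + 1) with hlt | heq | hgt
    · exact absurd h (bpt_strictMono ha' hlt (τ (β m)).2).ne
    · exact heq
    · exact absurd h (bpt_strictMono ha' hgt (τ (α m)).2.le).ne'
  | succ j ih =>
    intro h
    push_cast at h
    rw [← add_assoc] at h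
    set k : ℤ := m + 1 + j with hk
    have hsame : α k = β k → False := fun he => ih (by
      have h1 := hx k
      have h2 := hy k
      rw [he] at h1
      linarith)
    have hxk0 : x k = 0 := by
      by_contra h0
      have hI := mem_Ioo_of_mem_Jint (hαx k) h0 (hxD j)
      have h1 := bpt_add_translen a τ (α k)
      have h2 := bpt_succ_add_translen a τ (α k)
      have h3 : x (k + 1) ∈ Ioo (bpt (aperm a τ) (τ (α k) : ℕ))
          (bpt (aperm a τ) ((τ (α k) : ℕ) + 1)) := by
        rw [hx k]
        exact ⟨by linarith [hI.1], by linarith [hI.2]⟩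
      exact hsame (τ.injective (index_eq_of_mem_Ioo ha' h3
        (h ▸ Ioc_subset_Icc_self (himg' k))))
    have hj0 : j = 0 := by
      obtain _ | j := j
      · rfl
      · refine absurd (hT.mem_Dset_of_apply_eq_zero hn ha hirr (hxS (m + 1 + j)) ?_) (hxD j)
        rw [hT.apply_eq (hαx _), ← hx, ← hxk0, hk]
        push_cast
        rw [add_assoc (m + 1)]
    have hk1 : k = m + 1 := by simp [hk, hj0]
    have hτα : (τ (α m) : ℕ) = 0 := by
      by_contra hne0
      have h1 := bpt_strictMono ha' (Nat.pos_of_ne_zero hne0) (τ (α m)).2.le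
      rw [bpt_zero, ← hx1, ← hk1, hxk0] at h1
      exact lt_irrefl _ h1
    have hτβ : (τ (β m) : ℕ) + 1 < n := by
      by_contra hge
      have h1 := (hfs.2 (τ (α m)) (τ (β m)) hτα (by have := (τ (β m)).2; omega)).2
      rw [Equiv.symm_apply_apply, Equiv.symm_apply_apply] at h1
      exact h1 hβα.symm
    have hyk : y k = bpt (aperm a τ) ((τ (β m) : ℕ) + 1) := hk1 ▸ hy1
    have hTq : T (bpt a (τ.symm ⟨(τ (β m) : ℕ) + 1, hτβ⟩ : ℕ)) = y k := by
      rw [hT.apply_bpt ha, Equiv.apply_symm_apply, hyk]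
    have hyD : y k ∉ Dset a := by
      rcases Nat.eq_zero_or_pos (τ.symm ⟨(τ (β m) : ℕ) + 1, hτβ⟩ : ℕ) with h0 | hpos
      · have hxk : x k = T^[1] (x m) := by rw [hk1, ← hiter, Nat.cast_one]
        rw [h0, bpt_zero, ← hxk0, hxk, ← Function.iterate_succ_apply' T] at hTq
        rw [← hTq]
        exact hK.not_mem (Nat.succ_pos 1) hD
      · rw [← hTq]
        exact hK.not_mem one_pos ⟨_, hpos, Fin.is_lt _, rfl⟩
    have hy1' : y k ≠ 1 := by
      rw [hyk, ← bpt_top ha']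
      exact (bpt_strictMono ha' hτβ le_rfl).ne
    have hI := mem_Ioo_of_mem_Jtil ha (hβy k) hy1' hyD
    have h1 := bpt_add_translen a τ (β k)
    have h2 := bpt_succ_add_translen a τ (β k)
    have h3 : y (k + 1) ∈ Ioo (bpt (aperm a τ) (τ (β k) : ℕ))
        (bpt (aperm a τ) ((τ (β k) : ℕ) + 1)) := by
      rw [hy k]
      exact ⟨by linarith [hI.1], by linarith [hI.2]⟩
    exact hsame (τ.injective (index_eq_of_mem_Ioo ha' h3
      (h ▸ Ico_subset_Icc_self (himg k)))).symm

end Orbits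

/-- Theorems 1.1, 4.6: if `T` is irreducible, fully split and
satisfies the Keane Condition, then no pair of distinct points of `X` is doubly
asymptotic for the shift. -/
theorem stmt18 {n : ℕ} (hn : 2 ≤ n) (a : Fin n → ℝ) (ha : IsProbVec a)
    (τ : Equiv.Perm (Fin n)) (T Tt : ℝ → ℝ)
    (hT : IsLrIET a τ T) (hTt : IslRIET a τ Tt)
    (P Pt : ℤ → ℝ → ℝ) (hP : IsZIterLr T P) (hPt : IsZIterlR Tt Pt)
    (I It : ℝ → ℤ → Fin n) (hI : IsItin a P I) (hIt : IsItinDual a Pt It)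
    (hirr : IrreduciblePerm τ) (hKeane : KeaneCond a T)
    (hfs : FullySplitPerm τ) :
    ∀ α ∈ closure (I '' Rset a P), ∀ β ∈ closure (I '' Rset a P),
      α ≠ β → ¬ (PosAsymp α β ∧ NegAsymp α β) := by
  intro α hα β hβ hne ⟨⟨N, hN⟩, ⟨M, hM⟩⟩
  have hR : Rset a P ⊆ Ico 0 1 := fun z hz =>
    ⟨hz.1.1, lt_of_le_of_ne hz.1.2 fun h => hz.2 (Or.inl (by simp [h]))⟩
  have hU : MapsTo (P (-1)) (Ico 0 1) (Ico 0 1) := fun z hz => (hP.2 (-1) z hz).1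
  have hTU : ∀ z ∈ Ico (0 : ℝ) 1, T (P (-1) z) = z := fun z hz => by
    rw [← (hP.2 (-1) z hz).2, show (-1 : ℤ) + 1 = 0 by norm_num, hP.1 z hz]
  obtain ⟨x, hx, hαx⟩ := exists_orbit_of_mem_closure hT hP hI hR hα
  obtain ⟨y, hy, hβy⟩ := exists_orbit_of_mem_closure hT hP hI hR hβ
  have hcx : ClosedCoding a α x := hαx.elim (fun h k => Ico_subset_Icc_self (h k))
    fun h k => Ioc_subset_Icc_self (h k)
  have hcy : ClosedCoding a β y := hβy.elim (fun h k => Ico_subset_Icc_self (h k))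
    fun h k => Ioc_subset_Icc_self (h k)
  obtain ⟨m, hm, hpast⟩ : ∃ m, α m ≠ β m ∧ ∀ k, k < m → α k = β k := by
    obtain ⟨k, hk⟩ := Function.ne_iff.1 hne
    obtain ⟨m, hm, hmin⟩ := Int.exists_least_of_bdd (P := fun k => α k ≠ β k)
      ⟨-M, fun k hk => not_lt.1 fun hlt => hk (hM k hlt.le)⟩ ⟨k, hk⟩
    exact ⟨m, hm, fun k hk => by_contra fun h => absurd (hmin k h) (not_le.2 hk)⟩
  have hxym : x m = y m := eq_of_backward_coding hn ha hT hirr hKeane hU hTU hx hy hcx hcy hpast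
  obtain ⟨j, hj⟩ : ∃ j : ℕ, x (m + 1 + j) = y (m + 1 + j) :=
    ⟨((N : ℤ) - m).toNat, eq_of_forward_coding hn ha hT hirr hKeane hx hy hcx hcy
      fun k hk => hN k (by omega)⟩
  rcases hαx with hαx | hαx <;> rcases hβy with hβy | hβy
  · exact hne (coding_eq_of_common_past (Jint_unique ha) hx hy hαx hβy hxym hpast)
  · exact right_left_orbits_ne hn ha hT hirr hKeane hfs hx hy hαx hβy hxym hm j hj
  · exact right_left_orbits_ne hn ha hT hirr hKeane hfs hy hx hβy hαx hxym.symm hm.symm j hj.symm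
  · exact hne (coding_eq_of_common_past (Jtil_unique ha) hx hy hαx hβy hxym hpast)
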